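/- arXiv:math/0311388 — 2 statements merged into one kernel-verified Lean document; each statement's English description precedes it below -/
import Mathlib

section
/- Let T ∈ A₁ ⊗ ... ⊗ A_k be a tensor (k ≥ 3) such that for every partition of {1,...,k} into two nonempty subsets I and J, the flattening of T viewed as a linear map (A_I)* → A_J has rank at most 2. Then T lies in the (affine cone over the) second secant variety of the Segre variety; that is, T can be written as a limit of sums of two decomposable tensors a₁⊗...⊗a_k + b₁⊗...⊗b_k. Equivalently, σ_2(Seg(PA₁×...×PA_k)) is cut out set-theoretically by the 3×3 minors of flattenings. -/
/-- The flattening of a tensor `T ∈ A₁ ⊗ ⋯ ⊗ A_k` (encoded as a multi-indexed array)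
associated to a subset `I ⊆ {1,…,k}`: the matrix whose rows are indexed by the multi-indices
in the factors of `I` and whose columns are indexed by the multi-indices in the remaining
factors. -/
def flattening {k : ℕ} {n : Fin k → ℕ} (T : (∀ i, Fin (n i)) → ℂ) (I : Finset (Fin k)) :
    Matrix (∀ i : {i // i ∈ I}, Fin (n i)) (∀ i : {i // i ∉ I}, Fin (n i)) ℂ :=
  Matrix.of fun r c =>
    T fun i => if h : i ∈ I then r ⟨i, h⟩ else c ⟨i, h⟩

/-- 2x2 -/
lemma rank2_factor {m l : Type*} [Fintype m] [Fintype l] (M : Matrix m l ℂ) (h : M.rank ≤ 2) :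
    ∃ (p : Fin 2 → m → ℂ) (q : Fin 2 → l → ℂ), ∀ r c, M r c = p 0 r * q 0 c + p 1 r * q 1 c := by
  classical
  rw [Matrix.rank_eq_finrank_span_cols] at h
  set V := Submodule.span ℂ (Set.range M.col)
  let b := Module.finBasis ℂ V
  have hc : ∀ c, M.col c ∈ V := fun c => Submodule.subset_span ⟨c, rfl⟩
  refine ⟨fun t r => if ht : t.1 < Module.finrank ℂ V then (b ⟨t, ht⟩ : m → ℂ) r else 0,
    fun t c => if ht : t.1 < Module.finrank ℂ V then b.repr ⟨_, hc c⟩ ⟨t, ht⟩ else 0, ?_⟩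
  intro r c
  have h1 := congrArg (fun v : V => (v : m → ℂ) r) (b.sum_repr ⟨_, hc c⟩)
  simp only [Submodule.coe_sum, Submodule.coe_smul, Finset.sum_apply, Pi.smul_apply, smul_eq_mul] at h1
  have h2 : M r c = M.col c r := rfl
  rw [h2, ← h1]
  clear h1 h2
  clear_value b
  clear_value V
  revert b
  generalize Module.finrank ℂ V = d at *
  intro b
  interval_cases d
  · simp
  · simp [mul_comm]
  · simp [Fin.sum_univ_two, mul_comm]

lemma tangent_mem {ι : Type*} [Fintype ι] [DecidableEq ι] {n : ι → ℕ} (i0 : ι)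
    (T : (∀ i, Fin (n i)) → ℂ) (a b : ∀ i, Fin (n i) → ℂ)
    (h : ∀ x, T x = ∑ l, (∏ m ∈ Finset.univ.erase l, a m (x m)) * b l (x l)) :
    T ∈ closure {S : (∀ i, Fin (n i)) → ℂ |
      ∃ a b : ∀ i, Fin (n i) → ℂ,
        S = fun x => (∏ i, a i (x i)) + ∏ i, b i (x i)} := by
  have hd : HasDerivAt (fun (t : ℂ) (x : ∀ i, Fin (n i)) => ∏ l, (a l (x l) + t * b l (x l))) T 0 := by
    rw [hasDerivAt_pi]
    intro x
    have := HasDerivAt.fun_finsetProd (u := Finset.univ) (x := (0:ℂ)) 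
      (f := fun l (t:ℂ) => a l (x l) + t * b l (x l)) (f' := fun l => b l (x l)) (fun l _ => by
        simpa using ((hasDerivAt_id (0:ℂ)).mul_const (b l (x l))).const_add (a l (x l)))
    simpa [h x] using this
  rw [hasDerivAt_iff_tendsto_slope] at hd
  refine mem_closure_of_tendsto hd ?_
  filter_upwards with t
  have key : ∀ (c : ℂ) (u : ∀ i, Fin (n i) → ℂ) (x : ∀ i, Fin (n i)),
      ∏ l, (Function.update u i0 (fun r => c * u i0 r)) l (x l) = c * ∏ l, u l (x l) := by
    intro c u x
    rw [← Finset.mul_prod_erase _ _ (Finset.mem_univ i0),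
      ← Finset.mul_prod_erase _ (fun l => u l (x l)) (Finset.mem_univ i0), ← mul_assoc]
    congr 1
    · simp
    · apply Finset.prod_congr rfl
      intro l hl
      rw [Function.update_of_ne (Finset.ne_of_mem_erase hl)]
  refine ⟨Function.update (fun l r => a l r + t * b l r) i0 (fun r => t⁻¹ * (a i0 r + t * b i0 r)), 
    Function.update a i0 (fun r => -t⁻¹ * a i0 r), ?_⟩
  funext x
  rw [key t⁻¹ (fun l r => a l r + t * b l r), key]
  simp [slope_def_module]
  ring

lemma decomp {ι : Type*} [Fintype ι] [DecidableEq ι] {n : ι → ℕ} (w : (∀ i, Fin (n i)) → ℂ)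
    (p : ∀ i, Fin (n i)) (hp : w p ≠ 0) (S : Finset ι)
    (h : ∀ a ∈ S, ∀ x r, w (Function.update x a r) * w p
      = w (Function.update p a r) * w (Function.update x a (p a))) (x : ∀ i, Fin (n i)) :
    w (S.piecewise x p) = w p * ∏ l ∈ S, (w (Function.update p l (x l)) / w p) := by
  induction S using Finset.induction_on with
  | empty => simp
  | insert a s ha ih =>
    specialize ih (fun b hb => h b (Finset.mem_insert_of_mem hb))
    rw [Finset.piecewise_insert, Finset.prod_insert ha]
    have h1 := h a (Finset.mem_insert_self a s) (s.piecewise x p) (x a)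
    have h2 : Function.update (s.piecewise x p) a (p a) = s.piecewise x p := by
      apply Function.update_eq_self_iff.2; simp [ha]
    rw [h2, ih] at h1
    field_simp at h1 ⊢
    linear_combination h1

lemma tdecomp {ι : Type*} [Fintype ι] [DecidableEq ι] {n : ι → ℕ} (w w' : (∀ i, Fin (n i)) → ℂ)
    (p : ∀ i, Fin (n i)) (hp : w p ≠ 0) (S : Finset ι)
    (h : ∀ a ∈ S, ∀ x r, w (Function.update x a r) * w p
      = w (Function.update p a r) * w (Function.update x a (p a)))
    (h' : ∀ a ∈ S, ∀ x r, w' (Function.update x a r) * w p * w p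
      = w' (Function.update p a r) * w (Function.update x a (p a)) * w p
        + w (Function.update p a r) * w' (Function.update x a (p a)) * w p
        - w' p * w (Function.update p a r) * w (Function.update x a (p a))) (x : ∀ i, Fin (n i)) :
    w' (S.piecewise x p) = w' p * ∏ l ∈ S, (w (Function.update p l (x l)) / w p)
      + ∑ l ∈ S, (∏ m ∈ S.erase l, (w (Function.update p m (x m)) / w p)) *
        (w' (Function.update p l (x l)) - w' p * (w (Function.update p l (x l)) / w p)) := by
  induction S using Finset.induction_on with
  | empty => simp
  | insert a s ha ih =>
    have hd := decomp w p hp s (fun b hb => h b (Finset.mem_insert_of_mem hb)) x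
    specialize ih (fun b hb => h b (Finset.mem_insert_of_mem hb))
      (fun b hb => h' b (Finset.mem_insert_of_mem hb))
    rw [Finset.piecewise_insert, Finset.prod_insert ha, Finset.sum_insert ha, Finset.erase_insert ha]
    have h1 := h' a (Finset.mem_insert_self a s) (s.piecewise x p) (x a)
    have h2 : Function.update (s.piecewise x p) a (p a) = s.piecewise x p := by
      apply Function.update_eq_self_iff.2; simp [ha]
    have h3 : ∑ l ∈ s, (∏ m ∈ (insert a s).erase l, (w (Function.update p m (x m)) / w p)) *
        (w' (Function.update p l (x l)) - w' p * (w (Function.update p l (x l)) / w p))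
        = (w (Function.update p a (x a)) / w p) * 
          ∑ l ∈ s, (∏ m ∈ s.erase l, (w (Function.update p m (x m)) / w p)) *
        (w' (Function.update p l (x l)) - w' p * (w (Function.update p l (x l)) / w p)) := by
      rw [Finset.mul_sum]
      refine Finset.sum_congr rfl fun l hl => ?_
      have hne : a ≠ l := fun h => ha (h ▸ hl)
      rw [Finset.erase_insert_of_ne hne, Finset.prod_insert (by simp [ha])]
      ring
    rw [h2, hd] at h1
    rw [h3]
    have h4 : (w' (s.piecewise x p) - w' p * ∏ l ∈ s, (w (Function.update p l (x l)) / w p)) = 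
      ∑ l ∈ s, (∏ m ∈ s.erase l, (w (Function.update p m (x m)) / w p)) *
        (w' (Function.update p l (x l)) - w' p * (w (Function.update p l (x l)) / w p)) := by
      rw [ih]; ring
    rw [← h4]
    generalize ∏ l ∈ s, (w (Function.update p l (x l)) / w p) = R at *
    field_simp at h1 ⊢
    linear_combination h1
open Matrix in
lemma triang (X : Matrix (Fin 2) (Fin 2) ℂ) :
    ∃ B B' : Matrix (Fin 2) (Fin 2) ℂ, B * B' = 1 ∧ (B' * X * B) 1 0 = 0 := by
  by_cases h : X 1 0 = 0
  · exact ⟨1, 1, by simp, by simpa using h⟩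
  -- eigenvector (t, 1): want X 0 0 * t + X 0 1 = t * (X 1 0 * t + X 1 1)
  obtain ⟨d, hd⟩ : ∃ d : ℂ, d * d = (X 0 0 - X 1 1)^2 + 4 * X 1 0 * X 0 1 := by
    obtain ⟨d, hd⟩ := IsAlgClosed.exists_pow_nat_eq ((X 0 0 - X 1 1)^2 + 4 * X 1 0 * X 0 1) (n := 2) (by norm_num)
    exact ⟨d, by rw [← hd]; ring⟩
  set t := (X 0 0 - X 1 1 + d) / (2 * X 1 0) with ht
  have ht' : 2 * X 1 0 * t = X 0 0 - X 1 1 + d := by rw [ht]; field_simp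
  have hroot : X 1 0 * t * t + X 1 1 * t - X 0 0 * t - X 0 1 = 0 := by
    have : 4 * X 1 0 * (X 1 0 * t * t + X 1 1 * t - X 0 0 * t - X 0 1) = 0 := by
      linear_combination (2 * X 1 0 * t + d + X 1 1 - X 0 0) * ht' + hd
    simpa [h] using this
  refine ⟨!![t, 1; 1, 0], !![0, 1; 1, -t], ?_, ?_⟩
  · ext i j; fin_cases i <;> fin_cases j <;> simp [Matrix.mul_apply, Fin.sum_univ_two]
  · clear_value t
    simp [Matrix.mul_apply, Fin.sum_univ_two, Matrix.vecMul, dotProduct]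
    linear_combination -hroot

def PForm (M : Matrix (Fin 2) (Fin 2) ℂ) : Prop := M 0 1 = 0 ∧ M 1 0 = 0
def QForm (M : Matrix (Fin 2) (Fin 2) ℂ) : Prop := M 0 1 = M 1 0 ∧ M 1 1 = 0

lemma PForm.lin {M N : Matrix (Fin 2) (Fin 2) ℂ} (h : PForm M) (h' : PForm N) (a b : ℂ) :
    PForm (a • M + b • N) := by
  simp [PForm, h.1, h.2, h'.1, h'.2]
lemma QForm.lin {M N : Matrix (Fin 2) (Fin 2) ℂ} (h : QForm M) (h' : QForm N) (a b : ℂ) :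
    QForm (a • M + b • N) := by
  simp [QForm, h.1, h.2, h'.1, h'.2]

def SimForm (P Q : Matrix (Fin 2) (Fin 2) ℂ) : Prop :=
  ∃ A C B D : Matrix (Fin 2) (Fin 2) ℂ, C * A = 1 ∧ B * D = 1 ∧
    ((PForm (A * P * B) ∧ PForm (A * Q * B)) ∨ (QForm (A * P * B) ∧ QForm (A * Q * B)))

lemma simForm_one (X : Matrix (Fin 2) (Fin 2) ℂ) : SimForm 1 X := by
  obtain ⟨B, B', h, h0⟩ := triang X
  have h' : B' * B = 1 := mul_eq_one_comm.1 h
  set Y := B' * X * B with hY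
  by_cases hne : Y 0 0 = Y 1 1
  · have hJ : (!![0, 1; 1, 0] : Matrix (Fin 2) (Fin 2) ℂ) * !![0, 1; 1, 0] = 1 := by
      ext i j; fin_cases i <;> fin_cases j <;> simp [Matrix.mul_apply, Fin.sum_univ_two]
    refine ⟨B', B, B * !![0, 1; 1, 0], !![0, 1; 1, 0] * B', h, ?_, Or.inr ⟨?_, ?_⟩⟩
    · rw [Matrix.mul_assoc, ← Matrix.mul_assoc _ _ B', hJ, Matrix.one_mul, h]
    · rw [Matrix.mul_one, ← Matrix.mul_assoc, h']
      simp [QForm]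
    · rw [← Matrix.mul_assoc, ← hY]
      simp [QForm, Matrix.mul_apply, Fin.sum_univ_two, h0, hne]
  · have hne' : Y 0 0 - Y 1 1 ≠ 0 := sub_ne_zero.2 hne
    set s := Y 0 1 / (Y 0 0 - Y 1 1) with hs
    have hs' : s * (Y 0 0 - Y 1 1) = Y 0 1 := by rw [hs]; field_simp
    have hU : (!![1, s; 0, 1] : Matrix (Fin 2) (Fin 2) ℂ) * !![1, -s; 0, 1] = 1 := by
      ext i j; fin_cases i <;> fin_cases j <;> simp [Matrix.mul_apply, Fin.sum_univ_two]
    have hU' : (!![1, -s; 0, 1] : Matrix (Fin 2) (Fin 2) ℂ) * !![1, s; 0, 1] = 1 :=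
      mul_eq_one_comm.1 hU
    have e1 : B * !![1, -s; 0, 1] * (!![1, s; 0, 1] * B') = 1 := by
      rw [Matrix.mul_assoc, ← Matrix.mul_assoc _ _ B', hU', Matrix.one_mul, h]
    refine ⟨!![1, s; 0, 1] * B', B * !![1, -s; 0, 1], B * !![1, -s; 0, 1], !![1, s; 0, 1] * B',
      e1, e1, Or.inl ⟨?_, ?_⟩⟩
    · rw [Matrix.mul_one, mul_eq_one_comm.1 e1]
      simp [PForm]
    · have : !![1, s; 0, 1] * B' * X * (B * !![1, -s; 0, 1]) = !![1, s; 0, 1] * Y * !![1, -s; 0, 1] := by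
        rw [hY]; simp only [Matrix.mul_assoc]
      rw [this]
      clear_value s
      simp [PForm, Matrix.mul_apply, Fin.sum_univ_two, Matrix.vecMul, dotProduct, h0]
      linear_combination -hs'

lemma simForm_det {P : Matrix (Fin 2) (Fin 2) ℂ} (h : P.det ≠ 0) (Q : Matrix (Fin 2) (Fin 2) ℂ) :
    SimForm P Q := by
  have hu : IsUnit P.det := isUnit_iff_ne_zero.2 h
  obtain ⟨A, C, B, D, h1, h2, h3⟩ := simForm_one (P⁻¹ * Q)
  refine ⟨A * P⁻¹, P * C, B, D, ?_, h2, ?_⟩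
  · rw [Matrix.mul_assoc, ← Matrix.mul_assoc C, h1, Matrix.one_mul, Matrix.mul_nonsing_inv _ hu]
  · have e : A * P⁻¹ * P = A * 1 := by
      rw [Matrix.mul_assoc, Matrix.nonsing_inv_mul _ hu]
    rw [e, Matrix.mul_assoc A P⁻¹ Q]
    exact h3

lemma SimForm.comb {P Q P' Q' : Matrix (Fin 2) (Fin 2) ℂ} (h : SimForm P Q) (a b c d : ℂ)
    (h1 : P' = a • P + b • Q) (h2 : Q' = c • P + d • Q) : SimForm P' Q' := by
  obtain ⟨A, C, B, D, e1, e2, h3⟩ := h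
  refine ⟨A, C, B, D, e1, e2, ?_⟩
  have : ∀ a b : ℂ, A * (a • P + b • Q) * B = a • (A * P * B) + b • (A * Q * B) := by
    intro a b; simp [Matrix.mul_add, Matrix.add_mul]
  rw [h1, h2, this, this]
  rcases h3 with ⟨x, y⟩ | ⟨x, y⟩
  · exact Or.inl ⟨x.lin y _ _, x.lin y _ _⟩
  · exact Or.inr ⟨x.lin y _ _, x.lin y _ _⟩

lemma rank_one_two (P : Matrix (Fin 2) (Fin 2) ℂ) (h : P.det = 0) :
    ∃ u v : Fin 2 → ℂ, ∀ i j, P i j = u i * v j := by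
  rw [Matrix.det_fin_two] at h
  by_cases h0 : P 0 0 = 0
  · have : P 0 1 = 0 ∨ P 1 0 = 0 := by rw [h0] at h; simpa using h
    rcases this with h1 | h1
    · refine ⟨![0, 1], P 1, ?_⟩
      intro i j; fin_cases i <;> fin_cases j <;> simp [h0, h1]
    · refine ⟨fun i => P i 1, ![0, 1], ?_⟩
      intro i j; fin_cases i <;> fin_cases j <;> simp [h0, h1]
  · refine ⟨fun i => P i 0, fun j => P 0 j / P 0 0, ?_⟩
    intro i j; fin_cases i <;> fin_cases j <;> simp <;> field_simp
    linear_combination h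

lemma dep_two (u v : Fin 2 → ℂ) (h : u 0 * v 1 - u 1 * v 0 = 0) :
    ∃ (z : Fin 2 → ℂ) (s t : ℂ), (∀ i, u i = z i * s) ∧ ∀ i, v i = z i * t := by
  obtain ⟨z, s, hs⟩ := rank_one_two (!![u 0, v 0; u 1, v 1]) (by simp [Matrix.det_fin_two]; linear_combination h)
  refine ⟨z, s 0, s 1, ?_, ?_⟩
  · intro i; rw [← hs]; fin_cases i <;> simp
  · intro i; rw [← hs]; fin_cases i <;> simp

lemma pencil (P Q : Matrix (Fin 2) (Fin 2) ℂ) :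
    (∃ u p q : Fin 2 → ℂ, ∀ i j, P i j = u i * p j ∧ Q i j = u i * q j) ∨
    (∃ u p q : Fin 2 → ℂ, ∀ i j, P i j = p i * u j ∧ Q i j = q i * u j) ∨ SimForm P Q := by
  by_cases h1 : P.det = 0
  swap
  · exact Or.inr (Or.inr (simForm_det h1 Q))
  by_cases h2 : Q.det = 0
  swap
  · exact Or.inr (Or.inr ((simForm_det h2 P).comb 0 1 1 0 (by simp) (by simp)))
  by_cases h3 : (P + Q).det = 0
  swap
  · exact Or.inr (Or.inr ((simForm_det h3 Q).comb 1 (-1) 0 1 (by simp) (by simp)))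
  obtain ⟨u, v, hP⟩ := rank_one_two P h1
  obtain ⟨u', v', hQ⟩ := rank_one_two Q h2
  have : (u 0 * u' 1 - u 1 * u' 0) * (v 0 * v' 1 - v 1 * v' 0) = 0 := by
    rw [Matrix.det_fin_two] at h3
    simp only [Matrix.add_apply, hP, hQ] at h3
    linear_combination h3
  rcases mul_eq_zero.1 this with h | h
  · obtain ⟨z, s, t, hs, ht⟩ := dep_two _ _ h
    refine Or.inl ⟨z, fun j => s * v j, fun j => t * v' j, fun i j => ⟨?_, ?_⟩⟩
    · rw [hP, hs]; ring
    · rw [hQ, ht]; ring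
  · obtain ⟨z, s, t, hs, ht⟩ := dep_two _ _ h
    refine Or.inr (Or.inl ⟨z, fun j => u j * s, fun j => u' j * t, fun i j => ⟨?_, ?_⟩⟩)
    · rw [hP, hs]; ring
    · rw [hQ, ht]; ring

open Function Matrix

lemma decomp' {ι : Type*} [Fintype ι] [DecidableEq ι] {n : ι → ℕ} (w : (∀ i, Fin (n i)) → ℂ)
    (p : ∀ i, Fin (n i)) (hp : w p ≠ 0) (S : Finset ι)
    (h : ∀ a ∈ S, ∀ x r, w (Function.update x a r) * w p
      = w (Function.update p a r) * w (Function.update x a (p a))) (x : ∀ i, Fin (n i)) :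
    w x = (∏ l ∈ S, (w (Function.update p l (x l)) / w p)) * w (S.piecewise p x) := by
  induction S using Finset.induction_on with
  | empty => simp
  | insert a s ha ih =>
    specialize ih (fun b hb => h b (Finset.mem_insert_of_mem hb))
    rw [Finset.piecewise_insert, Finset.prod_insert ha]
    have h1 := h a (Finset.mem_insert_self a s) (s.piecewise p x) (x a)
    have h2 : Function.update (s.piecewise p x) a (x a) = s.piecewise p x := by
      apply Function.update_eq_self_iff.2; simp [ha]
    rw [h2] at h1
    have h3 : w (s.piecewise p x) = w (Function.update p a (x a)) *
        w (Function.update (s.piecewise p x) a (p a)) / w p := by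
      rw [← h1]; field_simp
    rw [ih, h3]
    ring

/-- factorization of a flattening of rank at most two -/
lemma flat_factor {k : ℕ} {n : Fin k → ℕ} (T : (∀ i, Fin (n i)) → ℂ) (I : Finset (Fin k))
    (h : (flattening T I).rank ≤ 2) :
    ∃ p q : Fin 2 → (∀ i, Fin (n i)) → ℂ, (∀ x, T x = p 0 x * q 0 x + p 1 x * q 1 x) ∧
      (∀ t x y, (∀ l ∈ I, x l = y l) → p t x = p t y) ∧
      (∀ t x y, (∀ l, l ∉ I → x l = y l) → q t x = q t y) := by
  obtain ⟨p, q, hpq⟩ := rank2_factor _ h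
  refine ⟨fun t x => p t (fun l => x l), fun t x => q t (fun l => x l), ?_, ?_, ?_⟩
  · intro x
    rw [← hpq]
    simp [flattening]
  · intro t x y hxy
    dsimp only
    congr 1
    funext l
    exact hxy l l.2
  · intro t x y hxy
    dsimp only
    congr 1
    funext l
    exact hxy l l.2

def Minor {k : ℕ} {n : Fin k → ℕ} (T : (∀ i, Fin (n i)) → ℂ) (i : Fin k) : Prop :=
  ∀ x y r s, T (update x i r) * T (update y i s) = T (update y i r) * T (update x i s)

lemma minor_of {k : ℕ} {n : Fin k → ℕ} {T : (∀ i, Fin (n i)) → ℂ} {i : Fin k}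
    (E : Fin (n i) → ℂ) (G : (∀ i, Fin (n i)) → ℂ) (hG : ∀ x r, G (update x i r) = G x)
    (h : ∀ x, T x = E (x i) * G x) : Minor T i := by
  intro x y r s
  simp only [h, hG, update_self]
  ring

lemma exact_two {k : ℕ} {n : Fin k → ℕ} (T : (∀ i, Fin (n i)) → ℂ) (i : Fin k)
    (h : (flattening T {i}).rank ≤ 2) (hm : ¬ Minor T i) :
    ∃ (r : Fin 2 → Fin (n i)) (e : Fin 2 → Fin (n i) → ℂ),
      ∀ x, T x = e 0 (x i) * T (update x i (r 0)) + e 1 (x i) * T (update x i (r 1)) := by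
  obtain ⟨p, q, hT, hp, hq⟩ := flat_factor T {i} h
  unfold Minor at hm
  push Not at hm
  obtain ⟨x0, y0, r, s, hne⟩ := hm
  obtain ⟨P, hP⟩ : ∃ P : Fin 2 → Fin (n i) → ℂ, ∀ t z c, p t (update z i c) = P t c :=
    ⟨fun t c => p t (update x0 i c), fun t z c => hp _ _ _ (by simp)⟩
  have hQ : ∀ t z c, q t (update z i c) = q t z := fun t z c => hq _ _ _ (by
    intro l hl
    rw [update_of_ne (by simpa using hl)])
  have key : ∀ z c, T (update z i c) = P 0 c * q 0 z + P 1 c * q 1 z := by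
    intro z c; rw [hT, hP, hP, hQ, hQ]
  have hδ : P 0 r * P 1 s - P 0 s * P 1 r ≠ 0 := by
    intro h0
    apply hne
    simp only [key]
    linear_combination (q 0 x0 * q 1 y0 - q 1 x0 * q 0 y0) * h0
  refine ⟨![r, s], ![fun t => (P 0 t * P 1 s - P 1 t * P 0 s) / (P 0 r * P 1 s - P 0 s * P 1 r),
    fun t => (P 0 r * P 1 t - P 1 r * P 0 t) / (P 0 r * P 1 s - P 0 s * P 1 r)], ?_⟩
  intro x
  have hx := key x (x i)
  rw [update_eq_self] at hx
  simp only [Matrix.cons_val_zero, Matrix.cons_val_one, key, hx]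
  rw [div_mul_eq_mul_div, div_mul_eq_mul_div, ← add_div, eq_div_iff hδ]
  ring

def Good {k : ℕ} {n : Fin k → ℕ} (T : (∀ i, Fin (n i)) → ℂ) (i j : Fin k)
    (W : (∀ i, Fin (n i)) → Matrix (Fin 2) (Fin 2) ℂ) : Prop :=
  (∃ (e : Fin (n i) → Fin 2 → ℂ) (f : Fin (n j) → Fin 2 → ℂ),
    ∀ x, T x = e (x i) ⬝ᵥ (W x *ᵥ f (x j))) ∧
  (∀ x r, W (update x i r) = W x) ∧ (∀ x r, W (update x j r) = W x) ∧
  (∀ a, a ≠ i → a ≠ j → ∃ (P : Fin (n a) → Matrix (Fin 2) (Fin 2) ℂ)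
    (Q : (∀ i, Fin (n i)) → Matrix (Fin 2) (Fin 2) ℂ), ∀ x r, W (update x a r) = P r * Q x)

lemma Good.change {k : ℕ} {n : Fin k → ℕ} {T : (∀ i, Fin (n i)) → ℂ} {i j : Fin k}
    {W : (∀ i, Fin (n i)) → Matrix (Fin 2) (Fin 2) ℂ} (h : Good T i j W)
    (A C B D : Matrix (Fin 2) (Fin 2) ℂ) (h1 : C * A = 1) (h2 : B * D = 1) :
    Good T i j (fun x => A * W x * B) := by
  obtain ⟨⟨e, f, hT⟩, hi, hj, ha⟩ := h
  refine ⟨⟨fun r => e r ᵥ* C, fun s => D *ᵥ f s, ?_⟩, ?_, ?_, ?_⟩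
  · intro x
    rw [hT, ← Matrix.dotProduct_mulVec, Matrix.mulVec_mulVec, Matrix.mulVec_mulVec]
    congr 2
    rw [Matrix.mul_assoc, Matrix.mul_assoc, h2, Matrix.mul_one, ← Matrix.mul_assoc, h1,
      Matrix.one_mul]
  · intro x r; simp only [hi]
  · intro x r; simp only [hj]
  · intro a h1 h2
    obtain ⟨P, Q, h⟩ := ha a h1 h2
    refine ⟨fun r => A * P r, fun x => Q x * B, ?_⟩
    intro x r
    simp only [h, Matrix.mul_assoc]

lemma good_exists {k : ℕ} (hk : 3 ≤ k) {n : Fin k → ℕ} (T : (∀ i, Fin (n i)) → ℂ)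
    (hrank : ∀ I : Finset (Fin k), I ≠ ∅ → I ≠ Finset.univ → (flattening T I).rank ≤ 2)
    (x0 : ∀ i, Fin (n i)) (i j : Fin k) (hij : i ≠ j) (hi : ¬ Minor T i) (hj : ¬ Minor T j) :
    ∃ (P Q : Matrix (Fin 2) (Fin 2) ℂ) (g0 g1 : (∀ i, Fin (n i)) → ℂ),
      (∀ x r, g0 (update x i r) = g0 x) ∧ (∀ x r, g0 (update x j r) = g0 x) ∧ 
      (∀ x r, g1 (update x i r) = g1 x) ∧ (∀ x r, g1 (update x j r) = g1 x) ∧ 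
      Good T i j (fun x => g0 x • P + g1 x • Q) := by
  have two : ∀ a b : Fin k, (flattening T {a, b}).rank ≤ 2 := by
    intro a b
    apply hrank
    · simp
    · intro h
      have h1 : ({a, b} : Finset (Fin k)).card ≤ 2 := Finset.card_le_two
      rw [h, Finset.card_univ, Fintype.card_fin] at h1
      omega
  obtain ⟨r, e, hr⟩ := exact_two T i (by rw [← Finset.pair_eq_singleton]; exact two i i) hi
  obtain ⟨s, f, hs⟩ := exact_two T j (by rw [← Finset.pair_eq_singleton]; exact two j j) hj
  obtain ⟨p, q, hT, hp, hq⟩ := flat_factor T {i, j} (two i j)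
  have hqi : ∀ t x r, q t (update x i r) = q t x := fun t x r => hq _ _ _ (by
    intro l hl
    rw [update_of_ne (by rintro rfl; simp at hl)])
  have hqj : ∀ t x r, q t (update x j r) = q t x := fun t x r => hq _ _ _ (by
    intro l hl
    rw [update_of_ne (by rintro rfl; simp at hl)])
  have hPQ : ∀ x α β, (q 0 x • (Matrix.of fun α β => p 0 (update (update x0 i (r α)) j (s β)))
     + q 1 x • (Matrix.of fun α β => p 1 (update (update x0 i (r α)) j (s β))) : Matrix _ _ ℂ) α β
      = T (update (update x i (r α)) j (s β)) := by
    intro x α β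
    have : ∀ t, p t (update (update x0 i (r α)) j (s β)) = p t (update (update x i (r α)) j (s β)) := by
      intro t
      apply hp
      intro l hl
      simp only [Finset.mem_insert, Finset.mem_singleton] at hl
      rcases hl with rfl | rfl
      · simp [update_of_ne hij]
      · simp
    simp only [Matrix.add_apply, Matrix.smul_apply, Matrix.of_apply, smul_eq_mul, hT, hqi, hqj, this]
    ring
  refine ⟨Matrix.of fun α β => p 0 (update (update x0 i (r α)) j (s β)), 
    Matrix.of fun α β => p 1 (update (update x0 i (r α)) j (s β)), q 0, q 1, hqi 0, hqj 0, hqi 1, 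
    hqj 1, ⟨fun r t => e t r, fun s t => f t s, ?_⟩, ?_, ?_, ?_⟩
  · intro x
    simp only [dotProduct, mulVec, Fin.sum_univ_two, hPQ]
    rw [hr x, hs (update x i (r 0)), hs (update x i (r 1))]
    simp only [update_of_ne hij.symm]
    ring
  · intro x r; simp only [hqi]
  · intro x r; simp only [hqj]
  · intro a hai haj
    obtain ⟨u, v, hT', hu, hv⟩ := flat_factor T {i, a} (two i a)
    refine ⟨fun c => Matrix.of fun α t => u t (update (update x0 a c) i (r α)),
      fun x => Matrix.of fun t β => v t (update x j (s β)), ?_⟩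
    intro x c
    beta_reduce
    ext α β
    rw [hPQ, hT']
    simp only [Matrix.mul_apply, Matrix.of_apply, Fin.sum_univ_two]
    have e1 : ∀ t, u t (update (update (update x a c) i (r α)) j (s β)) = 
        u t (update (update x0 a c) i (r α)) := by
      intro t
      apply hu
      intro l hl
      simp only [Finset.mem_insert, Finset.mem_singleton] at hl
      rcases hl with rfl | rfl
      · simp [update_of_ne hij]
      · simp [update_of_ne haj, update_of_ne hai]
    have e2 : ∀ t, v t (update (update (update x a c) i (r α)) j (s β)) = 
        v t (update x j (s β)) := by
      intro t
      apply hv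
      intro l hl
      simp only [Finset.mem_insert, Finset.mem_singleton, not_or] at hl
      by_cases hlj : l = j
      · subst hlj; simp
      · simp [update_of_ne hlj, update_of_ne hl.1, update_of_ne hl.2]
    simp only [e1, e2]

/-- the 3 by 3 minors of a product through `Fin 2` vanish -/
lemma minor3 (P0 P1 P2 Q0 Q1 Q2 : Fin 2 → ℂ) :
    (P0 ⬝ᵥ Q0) * ((P1 ⬝ᵥ Q1) * (P2 ⬝ᵥ Q2) - (P1 ⬝ᵥ Q2) * (P2 ⬝ᵥ Q1))
    - (P0 ⬝ᵥ Q1) * ((P1 ⬝ᵥ Q0) * (P2 ⬝ᵥ Q2) - (P1 ⬝ᵥ Q2) * (P2 ⬝ᵥ Q0))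
    + (P0 ⬝ᵥ Q2) * ((P1 ⬝ᵥ Q0) * (P2 ⬝ᵥ Q1) - (P1 ⬝ᵥ Q1) * (P2 ⬝ᵥ Q0)) = 0 := by
  simp only [dotProduct, Fin.sum_univ_two]
  ring

lemma Good.minor {k : ℕ} {n : Fin k → ℕ} {T : (∀ i, Fin (n i)) → ℂ} {i j : Fin k}
    {W : (∀ i, Fin (n i)) → Matrix (Fin 2) (Fin 2) ℂ} (h : Good T i j W) (a : Fin k)
    (hi : a ≠ i) (hj : a ≠ j) (α0 α1 α2 β0 β1 β2 : Fin 2) (r0 r1 r2 : Fin (n a))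
    (x0 x1 x2 : ∀ i, Fin (n i)) :
    (W (update x0 a r0) α0 β0) * ((W (update x1 a r1) α1 β1) * (W (update x2 a r2) α2 β2)
      - (W (update x2 a r1) α1 β2) * (W (update x1 a r2) α2 β1))
    - (W (update x1 a r0) α0 β1) * ((W (update x0 a r1) α1 β0) * (W (update x2 a r2) α2 β2)
      - (W (update x2 a r1) α1 β2) * (W (update x0 a r2) α2 β0))
    + (W (update x2 a r0) α0 β2) * ((W (update x0 a r1) α1 β0) * (W (update x1 a r2) α2 β1)
      - (W (update x1 a r1) α1 β1) * (W (update x0 a r2) α2 β0)) = 0 := by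
  obtain ⟨P, Q, hPQ⟩ := h.2.2.2 a hi hj
  simp only [hPQ, Matrix.mul_apply']
  exact minor3 _ _ _ _ _ _

lemma prod_two {k : ℕ} {n : Fin k → ℕ} (i j : Fin k) (hij : i ≠ j) (u : ∀ l, Fin (n l) → ℂ)
    (E : Fin (n i) → ℂ) (F : Fin (n j) → ℂ) (x : ∀ l, Fin (n l)) :
    ∏ l, (update (update u i E) j F) l (x l)
      = E (x i) * F (x j) * ∏ l ∈ (Finset.univ.erase i).erase j, u l (x l) := by
  rw [← Finset.mul_prod_erase _ _ (Finset.mem_univ i),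
    ← Finset.mul_prod_erase (Finset.univ.erase i) _ (a := j) (by simp [hij.symm]), ← mul_assoc]
  congr 1
  · simp [update_of_ne hij]
  · apply Finset.prod_congr rfl
    intro l hl
    simp only [Finset.mem_erase] at hl
    rw [update_of_ne hl.1, update_of_ne hl.2.1]

lemma prod_two_erase {k : ℕ} {n : Fin k → ℕ} (i j : Fin k) (hij : i ≠ j) (u : ∀ l, Fin (n l) → ℂ)
    (E : Fin (n i) → ℂ) (F : Fin (n j) → ℂ) (x : ∀ l, Fin (n l)) (m : Fin k) (hi : m ≠ i) (hj : m ≠ j) :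
    ∏ l ∈ Finset.univ.erase m, (update (update u i E) j F) l (x l)
      = E (x i) * F (x j) * ∏ l ∈ ((Finset.univ.erase i).erase j).erase m, u l (x l) := by
  rw [← Finset.mul_prod_erase _ _ (a := i) (by simp [hi.symm]),
    ← Finset.mul_prod_erase ((Finset.univ.erase m).erase i) _ (a := j) (by simp [hij.symm, hj.symm]),
    ← mul_assoc]
  congr 1
  · simp [update_of_ne hij]
  · have : ((Finset.univ.erase m).erase i).erase j = ((Finset.univ.erase i).erase j).erase m := by
      ext; simp; tauto
    rw [this]
    apply Finset.prod_congr rfl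
    intro l hl
    simp only [Finset.mem_erase] at hl
    rw [update_of_ne hl.2.1, update_of_ne hl.2.2.1]

lemma prod_two_erase_i {k : ℕ} {n : Fin k → ℕ} (i j : Fin k) (hij : i ≠ j) (u : ∀ l, Fin (n l) → ℂ)
    (E : Fin (n i) → ℂ) (F : Fin (n j) → ℂ) (x : ∀ l, Fin (n l)) :
    ∏ l ∈ Finset.univ.erase i, (update (update u i E) j F) l (x l)
      = F (x j) * ∏ l ∈ (Finset.univ.erase i).erase j, u l (x l) := by
  rw [← Finset.mul_prod_erase (Finset.univ.erase i) _ (a := j) (by simp [hij.symm])]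
  congr 1
  · simp
  · apply Finset.prod_congr rfl
    intro l hl
    simp only [Finset.mem_erase] at hl
    rw [update_of_ne hl.1, update_of_ne hl.2.1]

lemma prod_two_erase_j {k : ℕ} {n : Fin k → ℕ} (i j : Fin k) (hij : i ≠ j) (u : ∀ l, Fin (n l) → ℂ)
    (E : Fin (n i) → ℂ) (F : Fin (n j) → ℂ) (x : ∀ l, Fin (n l)) :
    ∏ l ∈ Finset.univ.erase j, (update (update u i E) j F) l (x l)
      = E (x i) * ∏ l ∈ (Finset.univ.erase i).erase j, u l (x l) := by
  rw [update_comm hij, prod_two_erase_i j i hij.symm, Finset.erase_right_comm]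

lemma pw_eq {k : ℕ} {n : Fin k → ℕ} (i j : Fin k) (hij : i ≠ j) {α : Type*}
    (w : (∀ l, Fin (n l)) → α) 
    (hi : ∀ x r, w (update x i r) = w x) (hj : ∀ x r, w (update x j r) = w x) 
    (x p : ∀ l, Fin (n l)) :
    w (((Finset.univ.erase i).erase j).piecewise x p) = w x := by
  have : ((Finset.univ.erase i).erase j).piecewise x p = update (update x i (p i)) j (p j) := by
    funext l
    by_cases hl : l = j
    · subst hl; simp
    · by_cases hl' : l = i
      · subst hl'; simp [update_of_ne hl]
      · simp [hl, hl', update_of_ne]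
  rw [this, hj, hi]

lemma case_diag {k : ℕ} {n : Fin k → ℕ} {T : (∀ i, Fin (n i)) → ℂ} {i j : Fin k} (hij : i ≠ j)
    {W : (∀ i, Fin (n i)) → Matrix (Fin 2) (Fin 2) ℂ} (h : Good T i j W) (hi : ¬ Minor T i)
    (hW : ∀ x, PForm (W x)) :
    ∃ a b : ∀ i, Fin (n i) → ℂ, T = fun x => (∏ i, a i (x i)) + ∏ i, b i (x i) := by
  obtain ⟨⟨e, f, hT⟩, hWi, hWj, -⟩ := id h
  have hT' : ∀ x, T x = e (x i) 0 * (f (x j) 0 * W x 0 0) + e (x i) 1 * (f (x j) 1 * W x 1 1) := by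
    intro x
    rw [hT]
    simp only [dotProduct, mulVec, Fin.sum_univ_two, (hW x).1, (hW x).2]
    ring
  obtain ⟨p1, hp1⟩ : ∃ p, W p 1 1 ≠ 0 := by
    by_contra! hc
    refine hi (minor_of (fun r => e r 0) (fun x => f (x j) 0 * W x 0 0) ?_ ?_)
    · intro x r; simp only [hWi, update_of_ne hij.symm]
    · intro x; rw [hT', hc]; ring
  obtain ⟨p0, hp0⟩ : ∃ p, W p 0 0 ≠ 0 := by
    by_contra! hc
    refine hi (minor_of (fun r => e r 1) (fun x => f (x j) 1 * W x 1 1) ?_ ?_)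
    · intro x r; simp only [hWi, update_of_ne hij.symm]
    · intro x; rw [hT', hc]; ring
  have m0 := decomp (fun x => W x 0 0) p0 hp0 ((Finset.univ.erase i).erase j) (by
    intro a ha x r
    simp only [Finset.mem_erase] at ha
    have := h.minor a ha.2.1 ha.1 0 0 1 0 0 1 r (p0 a) (p1 a) x p0 p1
    simp only [update_eq_self, (hW _).1, (hW _).2] at this
    apply mul_right_cancel₀ hp1
    linear_combination this)
  have m1 := decomp (fun x => W x 1 1) p1 hp1 ((Finset.univ.erase i).erase j) (by
    intro a ha x r
    simp only [Finset.mem_erase] at ha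
    have := h.minor a ha.2.1 ha.1 1 1 0 1 1 0 r (p1 a) (p0 a) x p1 p0
    simp only [update_eq_self, (hW _).1, (hW _).2] at this
    apply mul_right_cancel₀ hp0
    linear_combination this)
  refine ⟨update (update (fun l r => W (update p0 l r) 0 0 / W p0 0 0) i (fun r => e r 0)) j
      (fun s => f s 0 * W p0 0 0),
    update (update (fun l r => W (update p1 l r) 1 1 / W p1 1 1) i (fun r => e r 1)) j
      (fun s => f s 1 * W p1 1 1), ?_⟩
  funext x
  rw [prod_two _ _ hij, prod_two _ _ hij, hT']
  have m0 := m0 x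
  have m1 := m1 x
  simp only [pw_eq i j hij W hWi hWj x] at m0 m1
  rw [m0, m1]
  ring

lemma case_tan {k : ℕ} {n : Fin k → ℕ} {T : (∀ i, Fin (n i)) → ℂ} {i j : Fin k} (hij : i ≠ j)
    {W : (∀ i, Fin (n i)) → Matrix (Fin 2) (Fin 2) ℂ} (h : Good T i j W) (hi : ¬ Minor T i)
    (hW : ∀ x, QForm (W x)) :
    ∃ a b : ∀ i, Fin (n i) → ℂ, 
      ∀ x, T x = ∑ l, (∏ m ∈ Finset.univ.erase l, a m (x m)) * b l (x l) := by
  obtain ⟨⟨e, f, hT⟩, hWi, hWj, -⟩ := id h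
  have hT' : ∀ x, T x = e (x i) 0 * (f (x j) 0 * W x 0 0) + 
      (e (x i) 0 * f (x j) 1 + e (x i) 1 * f (x j) 0) * W x 1 0 := by
    intro x
    rw [hT]
    simp only [dotProduct, mulVec, Fin.sum_univ_two, (hW x).1, (hW x).2]
    ring
  obtain ⟨p, hp⟩ : ∃ p, W p 1 0 ≠ 0 := by
    by_contra! hc
    refine hi (minor_of (fun r => e r 0) (fun x => f (x j) 0 * W x 0 0) ?_ ?_)
    · intro x r; simp only [hWi, update_of_ne hij.symm]
    · intro x; rw [hT', hc]; ring
  have r0 : ∀ a ∈ ((Finset.univ.erase i).erase j), ∀ x r, W (update x a r) 1 0 * W p 1 0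
      = W (update p a r) 1 0 * W (update x a (p a)) 1 0 := by
    intro a ha x r
    simp only [Finset.mem_erase] at ha
    have := h.minor a ha.2.1 ha.1 0 0 1 1 1 0 r (p a) (p a) x p p
    simp only [update_eq_self, (hW _).1, (hW _).2] at this
    apply mul_right_cancel₀ hp
    linear_combination this
  have m0 := decomp (fun x => W x 1 0) p hp ((Finset.univ.erase i).erase j) r0
  have m1 := tdecomp (fun x => W x 1 0) (fun x => W x 0 0) p hp ((Finset.univ.erase i).erase j) r0 (by
    intro a ha x r
    simp only [Finset.mem_erase] at ha
    have := h.minor a ha.2.1 ha.1 0 0 1 0 0 1 r (p a) (p a) x p p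
    simp only [update_eq_self, (hW _).1, (hW _).2] at this
    linear_combination -this)
  refine ⟨update (update (fun l r => W (update p l r) 1 0 / W p 1 0) i (fun r => e r 0)) j
      (fun s => f s 0),
    update (update (fun l r => W (update p l r) 0 0 - W p 0 0 * (W (update p l r) 1 0 / W p 1 0)) 
      i (fun r => W p 1 0 * e r 1)) j
      (fun s => W p 1 0 * f s 1 + W p 0 0 * f s 0), ?_⟩
  intro x
  rw [← Finset.add_sum_erase _ _ (Finset.mem_univ i), 
    ← Finset.add_sum_erase (Finset.univ.erase i) _ (a := j) (by simp [hij.symm]),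
    prod_two_erase_i _ _ hij, prod_two_erase_j _ _ hij, hT']
  have m0 := m0 x
  have m1 := m1 x
  simp only [pw_eq i j hij W hWi hWj x] at m0 m1
  have h3 : ∀ l ∈ (Finset.univ.erase i).erase j, 
    (∏ m ∈ Finset.univ.erase l, (update (update (fun l r => W (update p l r) 1 0 / W p 1 0) i (fun r => e r 0)) j
      (fun s => f s 0)) m (x m)) * (update (update (fun l r => W (update p l r) 0 0 - W p 0 0 * (W (update p l r) 1 0 / W p 1 0)) 
      i (fun r => W p 1 0 * e r 1)) j
      (fun s => W p 1 0 * f s 1 + W p 0 0 * f s 0)) l (x l) = 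
     e (x i) 0 * f (x j) 0 * ((∏ m ∈ ((Finset.univ.erase i).erase j).erase l, 
      (W (update p m (x m)) 1 0 / W p 1 0)) * (W (update p l (x l)) 0 0 - W p 0 0 * (W (update p l (x l)) 1 0 / W p 1 0))) := by
    intro l hl
    simp only [Finset.mem_erase] at hl
    rw [prod_two_erase _ _ hij _ _ _ _ _ hl.2.1 hl.1, update_of_ne hl.1, update_of_ne hl.2.1]
    ring
  rw [Finset.sum_congr rfl h3, ← Finset.mul_sum, m0, m1]
  simp only [update_self, update_of_ne hij]
  ring

theorem gss_set_theoretic {k : ℕ} (hk : 3 ≤ k) (n : Fin k → ℕ)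
    (T : (∀ i, Fin (n i)) → ℂ)
    (hrank : ∀ I : Finset (Fin k), I ≠ ∅ → I ≠ Finset.univ → (flattening T I).rank ≤ 2) :
    T ∈ closure {S : (∀ i, Fin (n i)) → ℂ |
      ∃ a b : ∀ i, Fin (n i) → ℂ,
        S = fun x => (∏ i, a i (x i)) + ∏ i, b i (x i)} := by
  have i0 : Fin k := ⟨0, by omega⟩
  by_cases hz : ∃ p, T p ≠ 0
  swap
  · push Not at hz
    refine subset_closure ⟨fun _ _ => 0, fun _ _ => 0, ?_⟩
    funext x
    rw [hz, Finset.prod_eq_zero (Finset.mem_univ i0) rfl, add_zero]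
  obtain ⟨p, hp⟩ := hz
  by_cases hm : ∃ i j, i ≠ j ∧ ¬ Minor T i ∧ ¬ Minor T j
  swap
  · obtain ⟨i1, hi1⟩ : ∃ i1, ∀ l, l ≠ i1 → Minor T l := by
      by_cases h : ∃ i, ¬ Minor T i
      · obtain ⟨i, hi⟩ := h
        refine ⟨i, fun l hl => ?_⟩
        by_contra hc
        exact hm ⟨l, i, hl, hc, hi⟩
      · push Not at h
        exact ⟨i0, fun l _ => h l⟩
    have hd := decomp' T p hp (Finset.univ.erase i1) (by
      intro a ha x r
      have := hi1 a (Finset.ne_of_mem_erase ha) x p r (p a)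
      rwa [update_eq_self] at this)
    refine subset_closure ⟨update (fun l r => T (update p l r) / T p) i1 (fun r => T (update p i1 r)),
      fun _ _ => 0, ?_⟩
    funext x
    have e1 : (Finset.univ.erase i1).piecewise p x = update p i1 (x i1) := by
      funext l
      by_cases hl : l = i1
      · subst hl; simp
      · simp [hl]
    rw [Finset.prod_eq_zero (s := Finset.univ) (f := fun _ => (0:ℂ)) (Finset.mem_univ i0) rfl, add_zero,
      hd x, e1, ← Finset.mul_prod_erase _ _ (Finset.mem_univ i1), update_self, mul_comm]
    congr 1
    refine Finset.prod_congr rfl fun l hl => ?_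
    rw [update_of_ne (Finset.ne_of_mem_erase hl)]
  obtain ⟨i, j, hij, hi, hj⟩ := hm
  obtain ⟨P, Q, g0, g1, h0i, h0j, h1i, h1j, hG⟩ := good_exists hk T hrank p i j hij hi hj
  rcases pencil P Q with ⟨u, v, v', hu⟩ | ⟨u, v, v', hu⟩ | ⟨A, C, B, D, hCA, hBD, hf⟩
  · exfalso
    obtain ⟨⟨e, f, hT⟩, -⟩ := hG
    refine hi (minor_of (fun r => e r ⬝ᵥ u) (fun x => (g0 x • v + g1 x • v') ⬝ᵥ f (x j)) ?_ ?_)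
    · intro x r; simp only [h0i, h1i, update_of_ne hij.symm]
    · intro x
      rw [hT]
      simp [dotProduct, mulVec, Fin.sum_univ_two, fun i j => (hu i j).1, fun i j => (hu i j).2]
      ring
  · exfalso
    obtain ⟨⟨e, f, hT⟩, -⟩ := hG
    refine hj (minor_of (fun r => f r ⬝ᵥ u) (fun x => (g0 x • v + g1 x • v') ⬝ᵥ e (x i)) ?_ ?_)
    · intro x r; simp only [h0j, h1j, update_of_ne hij]
    · intro x
      rw [hT]
      simp [dotProduct, mulVec, Fin.sum_univ_two, fun i j => (hu i j).1, fun i j => (hu i j).2]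
      ring
  · have hG' := hG.change A C B D hCA hBD
    have this : ∀ a b : ℂ, A * (a • P + b • Q) * B = a • (A * P * B) + b • (A * Q * B) := by
      intro a b; simp [Matrix.mul_add, Matrix.add_mul]
    simp only [this] at hG'
    rcases hf with ⟨hP, hQ⟩ | ⟨hP, hQ⟩
    · exact subset_closure (case_diag hij hG' hi (fun x => hP.lin hQ _ _))
    · obtain ⟨a, b, hab⟩ := case_tan hij hG' hi (fun x => hP.lin hQ _ _)
      exact tangent_mem i0 T a b hab
end

section
/- Let A, B, C each be 3-dimensional complex vector spaces. The polynomial P on A⊗B⊗C of degree 9 obtained by symmetrizing F(a₁b₁c₁,...,a₉b₉c₉) = det(a₁,a₂,a₃)det(a₄,a₅,a₆)det(a₇,a₈,a₉)·det(b₂,b₃,b₄)det(b₅,b₆,b₇)det(b₁,b₈,b₉)·det(c₃,c₄,c₅)det(c₆,c₇,c₈)det(c₁,c₂,c₉) over S₉ is not identically zero. -/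
/-- The determinant of three vectors of `ℂ³` (with respect to the standard volume form). -/
noncomputable def det3 (x y z : Fin 3 → ℂ) : ℂ := Matrix.det (Matrix.of ![x, y, z])

/-- The multilinear form `F` on nine decomposable tensors `aᵢ ⊗ bᵢ ⊗ cᵢ` in `A ⊗ B ⊗ C`
(all spaces `ℂ³`), namely
`det(a₁,a₂,a₃)det(a₄,a₅,a₆)det(a₇,a₈,a₉) · det(b₂,b₃,b₄)det(b₅,b₆,b₇)det(b₁,b₈,b₉) ·
 det(c₃,c₄,c₅)det(c₆,c₇,c₈)det(c₁,c₂,c₉)` (indices shifted to `0,…,8`). -/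
noncomputable def F333 (a b c : Fin 9 → (Fin 3 → ℂ)) : ℂ :=
  det3 (a 0) (a 1) (a 2) * det3 (a 3) (a 4) (a 5) * det3 (a 6) (a 7) (a 8) *
  det3 (b 1) (b 2) (b 3) * det3 (b 4) (b 5) (b 6) * det3 (b 0) (b 7) (b 8) *
  det3 (c 2) (c 3) (c 4) * det3 (c 5) (c 6) (c 7) * det3 (c 0) (c 1) (c 8)

/-- Weight by the sign of the triple `(x, y, z)` (zero if not a permutation),
lazily in the last argument. -/
def sgnMul (x y z : Fin 3) (t : ℤ) : ℤ :=
  match x, y, z with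
  | 0, 1, 2 => t
  | 1, 2, 0 => t
  | 2, 0, 1 => t
  | 0, 2, 1 => -t
  | 2, 1, 0 => -t
  | 1, 0, 2 => -t
  | _, _, _ => 0

/-- First factors of the seven basis tensors whose sum is the test tensor. -/
def tA : Fin 7 → Fin 3 := ![2, 1, 0, 2, 1, 0, 0]
/-- Second factors. -/
def tB : Fin 7 → Fin 3 := ![2, 0, 1, 0, 1, 1, 2]
/-- Third factors. -/
def tC : Fin 7 → Fin 3 := ![1, 0, 0, 2, 2, 1, 2]

/-- Standard basis vectors. -/
noncomputable def ee (i : Fin 3) : Fin 3 → ℂ := Pi.single i 1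

theorem sgnMul_eq (x y z : Fin 3) (t : ℤ) : sgnMul x y z t = sgnMul x y z 1 * t := by
  fin_cases x <;> fin_cases y <;> fin_cases z <;> simp [sgnMul]

theorem det3_ee (x y z : Fin 3) : det3 (ee x) (ee y) (ee z) = (sgnMul x y z 1 : ℤ) := by
  fin_cases x <;> fin_cases y <;> fin_cases z <;>
    simp [sgnMul, det3, ee, Matrix.det_fin_three, Pi.single_apply]

/-- Sum over seven indices. -/
def sum7 (g : Fin 7 → ℤ) : ℤ := g 0 + g 1 + g 2 + g 3 + g 4 + g 5 + g 6

theorem sum7_eq (g : Fin 7 → ℤ) : sum7 g = ∑ i, g i := (Fin.sum_univ_seven g).symm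

/-- The value of the degree nine polynomial at the test tensor. -/
def nested : ℤ :=
  sum7 fun i0 => sum7 fun i1 => sum7 fun i2 =>
  sgnMul (tA i0) (tA i1) (tA i2) <| sum7 fun i3 =>
  sgnMul (tB i1) (tB i2) (tB i3) <| sum7 fun i4 =>
  sgnMul (tC i2) (tC i3) (tC i4) <| sum7 fun i5 =>
  sgnMul (tA i3) (tA i4) (tA i5) <| sum7 fun i6 =>
  sgnMul (tB i4) (tB i5) (tB i6) <| sum7 fun i7 =>
  sgnMul (tC i5) (tC i6) (tC i7) <| sum7 fun i8 =>
  sgnMul (tA i6) (tA i7) (tA i8) <|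
  sgnMul (tB i0) (tB i7) (tB i8) <|
  sgnMul (tC i0) (tC i1) (tC i8) 1

theorem nested_eq : nested = -252 := by decide +kernel

/-- Integer version of `F333` on the basis tensors selected by `f`. -/
def Fz (f : Fin 9 → Fin 7) : ℤ :=
  sgnMul (tA (f 0)) (tA (f 1)) (tA (f 2)) 1 * sgnMul (tA (f 3)) (tA (f 4)) (tA (f 5)) 1 *
  sgnMul (tA (f 6)) (tA (f 7)) (tA (f 8)) 1 *
  sgnMul (tB (f 1)) (tB (f 2)) (tB (f 3)) 1 * sgnMul (tB (f 4)) (tB (f 5)) (tB (f 6)) 1 *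
  sgnMul (tB (f 0)) (tB (f 7)) (tB (f 8)) 1 *
  sgnMul (tC (f 2)) (tC (f 3)) (tC (f 4)) 1 * sgnMul (tC (f 5)) (tC (f 6)) (tC (f 7)) 1 *
  sgnMul (tC (f 0)) (tC (f 1)) (tC (f 8)) 1

theorem F333_eq (f : Fin 9 → Fin 7) :
    F333 (fun i => ee (tA (f i))) (fun i => ee (tB (f i))) (fun i => ee (tC (f i)))
      = (Fz f : ℤ) := by
  simp only [F333, det3_ee, Fz, Int.cast_mul]

theorem sum_cons (n : ℕ) (g : (Fin (n + 1) → Fin 7) → ℤ) :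
    ∑ f, g f = ∑ i, ∑ f : Fin n → Fin 7, g (Matrix.vecCons i f) := by
  rw [← (Fin.consEquiv (fun _ => Fin 7)).sum_comp, Fintype.sum_prod_type]
  rfl

theorem sum_Fz : ∑ f, Fz f = nested := by
  have h : ∑ f, Fz f = ∑ i0, ∑ i1, ∑ i2, ∑ i3, ∑ i4, ∑ i5, ∑ i6, ∑ i7, ∑ i8,
      Fz ![i0, i1, i2, i3, i4, i5, i6, i7, i8] := by
    simp only [sum_cons, Finset.univ_unique, Finset.sum_singleton]
    rfl
  rw [h, nested]
  simp only [sum7_eq]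
  refine Finset.sum_congr rfl fun i0 _ => Finset.sum_congr rfl fun i1 _ =>
    Finset.sum_congr rfl fun i2 _ => ?_
  rw [sgnMul_eq, Finset.mul_sum]
  refine Finset.sum_congr rfl fun i3 _ => ?_
  rw [sgnMul_eq (tB i1), Finset.mul_sum, Finset.mul_sum]
  refine Finset.sum_congr rfl fun i4 _ => ?_
  rw [sgnMul_eq (tC i2)]
  simp only [Finset.mul_sum]
  refine Finset.sum_congr rfl fun i5 _ => ?_
  rw [sgnMul_eq (tA i3)]
  simp only [Finset.mul_sum]
  refine Finset.sum_congr rfl fun i6 _ => ?_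
  rw [sgnMul_eq (tB i4)]
  simp only [Finset.mul_sum]
  refine Finset.sum_congr rfl fun i7 _ => ?_
  rw [sgnMul_eq (tC i5)]
  simp only [Finset.mul_sum]
  refine Finset.sum_congr rfl fun i8 _ => ?_
  rw [sgnMul_eq (tA i6), sgnMul_eq (tB i0) _ _ (sgnMul _ _ _ _)]
  change sgnMul (tA i0) (tA i1) (tA i2) 1 * sgnMul (tA i3) (tA i4) (tA i5) 1 *
    sgnMul (tA i6) (tA i7) (tA i8) 1 *
    sgnMul (tB i1) (tB i2) (tB i3) 1 * sgnMul (tB i4) (tB i5) (tB i6) 1 *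
    sgnMul (tB i0) (tB i7) (tB i8) 1 *
    sgnMul (tC i2) (tC i3) (tC i4) 1 * sgnMul (tC i5) (tC i6) (tC i7) 1 *
    sgnMul (tC i0) (tC i1) (tC i8) 1 = _
  ring

/-- The degree-9 polynomial `P` on `A ⊗ B ⊗ C` obtained by symmetrizing `F333` over `S₉` is
 not identically zero: equivalently, since the symmetrization is a symmetric multilinear form
and decomposable tensors span `A ⊗ B ⊗ C`, there exist decomposable arguments on which the
symmetrization of `F333` does not vanish. -/
theorem symmetrization_F333_ne_zero :
    ∃ a b c : Fin 9 → (Fin 3 → ℂ),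
      ∑ σ : Equiv.Perm (Fin 9), F333 (a ∘ σ) (b ∘ σ) (c ∘ σ) ≠ 0 := by
  by_contra! hcon
  have key : ∀ f : Fin 9 → Fin 7, ∑ σ : Equiv.Perm (Fin 9), Fz (f ∘ σ) = 0 := by
    intro f
    have h := hcon (fun i => ee (tA (f i))) (fun i => ee (tB (f i))) (fun i => ee (tC (f i)))
    have h2 : ∑ σ : Equiv.Perm (Fin 9), ((Fz (f ∘ σ) : ℤ) : ℂ) = 0 := by
      rw [← h]
      exact Finset.sum_congr rfl fun σ _ => (F333_eq (f ∘ σ)).symm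
    exact_mod_cast h2
  have h1 : ∑ f : Fin 9 → Fin 7, ∑ σ : Equiv.Perm (Fin 9), Fz (f ∘ σ) = 0 :=
    Finset.sum_eq_zero fun f _ => key f
  rw [Finset.sum_comm] at h1
  have h3 : ∀ σ : Equiv.Perm (Fin 9), ∑ f : Fin 9 → Fin 7, Fz (f ∘ σ) = -252 := by
    intro σ
    rw [← nested_eq, ← sum_Fz]
    exact (Equiv.arrowCongr σ.symm (Equiv.refl (Fin 7))).sum_comp Fz
  rw [Finset.sum_congr rfl fun σ _ => h3 σ, Finset.sum_const, Finset.card_univ,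
    Fintype.card_perm, Fintype.card_fin, smul_eq_zero] at h1
  rcases h1 with h1 | h1
  · exact Nat.factorial_ne_zero 9 h1
  · norm_num at h1
end
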